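/- arXiv:2101.04058 — 3 statements merged into one kernel-verified Lean document; each statement's English description precedes it below -/
import Mathlib

section
/- For all integers n ≥ 0, PD_3(n) ≡ e_{n,1} (mod 3), where e_{n,1} denotes the number of pairs (k_0, k_1) of integers such that n = k_0² + 3k_1² and, for each i ∈ {0,1}, if k_i is odd then k_i > 0 (even k_i may be any integer of either sign). -/
/-- `PD k n` is the number of partitions of `n` with designated summands whose parts are
not divisible by `k`: the sum over partitions of `n` with no part divisible by `k` of the
product of the multiplicities of the distinct part sizes. -/
def PD (k n : ℕ) : ℕ :=
  ∑ p : n.Partition,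
    if ∀ s ∈ p.parts, ¬ k ∣ s then ∏ s ∈ p.parts.toFinset, p.parts.count s else 0

open Finset PowerSeries Filter
open scoped PowerSeries.WithPiTopology

section Gauss

variable {R : Type*} [CommRing R]

lemma gauss_telescope (x : R) (D : ℕ → R)
    (hD : ∀ s, D (s + 1) * (1 - x ^ (s + 1)) = D s * (1 + x ^ s)) (N m : ℕ) :
    (1 - x ^ N) * ∑ s ∈ range m, (-1) ^ s * x ^ (s * (N + 1)) * D s
      - (1 + x ^ N) * ∑ s ∈ range m, (-1) ^ s * x ^ (s * N) * D s
      = (-1) ^ m * x ^ (m * N) * D m * (1 - x ^ m) := by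
  induction m with
  | zero => simp
  | succ m ih =>
    rw [sum_range_succ, sum_range_succ]
    have h := hD m
    have e1 : x ^ (m * (N + 1)) = x ^ (m * N) * x ^ m := by ring
    have e2 : x ^ ((m + 1) * N) = x ^ (m * N) * x ^ N := by ring
    rw [e1, e2, pow_succ (-1 : R)]
    linear_combination ih + (-1) ^ m * x ^ (m * N) * x ^ N * h

/-- Shanks' finite form of Gauss' identity `∏ (1 - x ^ i) / (1 + x ^ i) = ∑ (-1) ^ j x ^ (j ^ 2)`. -/
theorem gauss_partial_sum [IsDomain R] (x : R) (P D : ℕ → R) (hP0 : P 0 = 1) (hD0 : D 0 = 1)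
    (hP : ∀ n, P (n + 1) * (1 + x ^ (n + 1)) = P n * (1 - x ^ (n + 1)))
    (hD : ∀ s, D (s + 1) * (1 - x ^ (s + 1)) = D s * (1 + x ^ s))
    (hx : ∀ n, 1 + x ^ (n + 1) ≠ 0) (n : ℕ) :
    1 + 2 * ∑ j ∈ range n, (-1) ^ (j + 1) * x ^ ((j + 1) ^ 2)
      = P n * ∑ s ∈ range (n + 1), (-1) ^ s * x ^ (s * (n + 1)) * D s := by
  have hPD : ∀ n, P n * D n * (1 + x ^ n) = 2 := by
    intro n
    induction n with
    | zero => simp [hP0, hD0]; norm_num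
    | succ n ih => linear_combination D (n + 1) * hP n + P n * hD n + ih
  induction n with
  | zero => simp [hP0, hD0]
  | succ n ih =>
    apply mul_right_cancel₀ (hx n)
    have ht := gauss_telescope x D hD (n + 1) (n + 1)
    rw [sum_range_succ, mul_add 2, ← add_assoc, ih, sum_range_succ _ (n + 1)]
    have e1 : x ^ ((n + 1) * (n + 1 + 1)) = x ^ ((n + 1) ^ 2) * x ^ (n + 1) := by ring
    have e2 : x ^ ((n + 1) * (n + 1)) = x ^ ((n + 1) ^ 2) := by ring
    rw [e2] at ht
    rw [e1]
    set S := ∑ s ∈ range (n + 1), (-1) ^ s * x ^ (s * (n + 1)) * D s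
    set T := ∑ s ∈ range (n + 1), (-1) ^ s * x ^ (s * (n + 1 + 1)) * D s
    set y := x ^ (n + 1)
    set z := x ^ ((n + 1) ^ 2)
    linear_combination -(T + (-1) ^ (n + 1) * (z * y) * D (n + 1)) * hP n - P n * ht
      - (1 + y) * (-1) ^ (n + 1) * z * (hPD n + P n * hD n)

end Gauss

section GaussSeries

variable {K : Type*} [Field K]

lemma X_pow_dvd_gauss_sub (n : ℕ) :
    (X : K⟦X⟧) ^ (n + 1) ∣
      (1 + 2 * ∑ j ∈ range n, (-1) ^ (j + 1) * X ^ ((j + 1) ^ 2)) * ∏ i ∈ range n, (1 + X ^ (i + 1))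
        - ∏ i ∈ range n, (1 - X ^ (i + 1)) := by
  have ha (n : ℕ) : (1 + (X : K⟦X⟧) ^ (n + 1))⁻¹ * (1 + X ^ (n + 1)) = 1 :=
    PowerSeries.inv_mul_cancel _ (by simp)
  have hs (n : ℕ) : (1 - (X : K⟦X⟧) ^ (n + 1))⁻¹ * (1 - X ^ (n + 1)) = 1 :=
    PowerSeries.inv_mul_cancel _ (by simp)
  have hx (n : ℕ) : 1 + (X : K⟦X⟧) ^ (n + 1) ≠ 0 := right_ne_zero_of_mul_eq_one (ha n)
  let P : ℕ → K⟦X⟧ := fun n ↦ ∏ i ∈ range n, ((1 - X ^ (i + 1)) * (1 + X ^ (i + 1))⁻¹)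
  let D : ℕ → K⟦X⟧ := fun n ↦ ∏ i ∈ range n, ((1 + X ^ i) * (1 - X ^ (i + 1))⁻¹)
  have hP (n : ℕ) : P (n + 1) * (1 + X ^ (n + 1)) = P n * (1 - X ^ (n + 1)) := by
    simp only [P, prod_range_succ]
    rw [mul_assoc, mul_assoc, ha, mul_one]
  have hD (n : ℕ) : D (n + 1) * (1 - X ^ (n + 1)) = D n * (1 + X ^ n) := by
    simp only [D, prod_range_succ]
    rw [mul_assoc, mul_assoc, hs, mul_one]
  have hPE : P n * ∏ i ∈ range n, (1 + X ^ (i + 1)) = ∏ i ∈ range n, (1 - X ^ (i + 1)) := by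
    simp only [P, ← prod_mul_distrib, mul_assoc, ha, mul_one]
  rw [gauss_partial_sum X P D (by simp [P]) (by simp [D]) hP hD hx n, sum_range_succ']
  rw [← hPE]
  have : (X : K⟦X⟧) ^ (n + 1) ∣
      ∑ s ∈ range n, (-1) ^ (s + 1) * X ^ ((s + 1) * (n + 1)) * D (s + 1) := by
    refine dvd_sum fun s _ ↦ Dvd.dvd.mul_right (Dvd.dvd.mul_left (pow_dvd_pow _ ?_) _) _
    nlinarith
  refine (this.mul_left (P n * ∏ i ∈ range n, (1 + X ^ (i + 1)))).trans (dvd_of_eq ?_)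
  have hD0 : D 0 = 1 := by simp [D]
  rw [hD0]
  simp
  ring

theorem gauss_mul_eq [TopologicalSpace K] [IsTopologicalRing K] [T2Space K] {f E O : K⟦X⟧}
    (hE : HasProd (fun i ↦ 1 - X ^ (i + 1)) E) (hO : HasProd (fun i ↦ 1 + X ^ (i + 1)) O)
    (hf : ∀ d n, d ≤ n →
      coeff d f = coeff d (1 + 2 * ∑ j ∈ range n, (-1 : K⟦X⟧) ^ (j + 1) * X ^ ((j + 1) ^ 2))) :
    f * O = E := by
  have h1 : Tendsto (fun n ↦ (1 + 2 * ∑ j ∈ range n, (-1 : K⟦X⟧) ^ (j + 1) * X ^ ((j + 1) ^ 2)))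
      atTop (nhds f) := by
    rw [WithPiTopology.tendsto_iff_coeff_tendsto]
    exact fun d ↦ tendsto_atTop_of_eventually_const fun n (hn : d ≤ n) ↦ (hf d n hn).symm
  have h2 := (h1.mul hO.tendsto_prod_nat).sub hE.tendsto_prod_nat
  have h3 : Tendsto (fun n ↦ (1 + 2 * ∑ j ∈ range n, (-1 : K⟦X⟧) ^ (j + 1) * X ^ ((j + 1) ^ 2))
      * ∏ i ∈ range n, (1 + X ^ (i + 1)) - ∏ i ∈ range n, (1 - X ^ (i + 1))) atTop (nhds 0) := by
    rw [WithPiTopology.tendsto_iff_coeff_tendsto]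
    refine fun d ↦ tendsto_atTop_of_eventually_const (i₀ := d) fun n hn ↦ ?_
    rw [X_pow_dvd_iff.mp (X_pow_dvd_gauss_sub n) d (by omega), map_zero]
  exact sub_eq_zero.mp (tendsto_nhds_unique h2 h3)

end GaussSeries

/-- The integers `k` with `k ^ 2 = d` which are positive if odd. -/
noncomputable def signedRoots (d : ℕ) : Finset ℤ :=
  {k ∈ Icc (-(d : ℤ)) d | k ^ 2 = d ∧ (Odd k → 0 < k)}

lemma mem_signedRoots {d : ℕ} {k : ℤ} :
    k ∈ signedRoots d ↔ k ^ 2 = d ∧ (Odd k → 0 < k) := by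
  simp only [signedRoots, mem_filter, mem_Icc, and_iff_right_iff_imp, and_imp]
  intro h _
  constructor <;> nlinarith

lemma card_signedRoots_sq (m : ℕ) :
    ((#(signedRoots ((m + 1) ^ 2)) : ℕ) : ZMod 3) = 2 * (-1) ^ (m + 1) := by
  rcases Nat.even_or_odd (m + 1) with h | h
  · have : signedRoots ((m + 1) ^ 2) = {((m + 1 : ℕ) : ℤ), -((m + 1 : ℕ) : ℤ)} := by
      ext k
      simp only [mem_signedRoots, mem_insert, mem_singleton, Nat.cast_pow, sq_eq_sq_iff_eq_or_eq_neg,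
        and_iff_left_iff_imp]
      have h' : Even ((m + 1 : ℕ) : ℤ) := mod_cast h
      rintro (rfl | rfl) ho
      · exact absurd ho (Int.not_odd_iff_even.mpr h')
      · exact absurd ho (Int.not_odd_iff_even.mpr h'.neg)
    rw [this, card_pair (by omega), h.neg_one_pow]
    simp
  · have : signedRoots ((m + 1) ^ 2) = {((m + 1 : ℕ) : ℤ)} := by
      ext k
      simp only [mem_signedRoots, mem_singleton, Nat.cast_pow, sq_eq_sq_iff_eq_or_eq_neg]
      have h' : Odd ((m + 1 : ℕ) : ℤ) := mod_cast h
      constructor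
      · rintro ⟨rfl | rfl, ho⟩
        · rfl
        · have := ho h'.neg
          omega
      · rintro rfl
        exact ⟨Or.inl rfl, fun _ ↦ by omega⟩
    rw [this, card_singleton, h.neg_one_pow]
    decide

/-- The generating function of `#(signedRoots d)` mod 3, equal to `∑ (-1) ^ k X ^ (k ^ 2)`. -/
noncomputable def signedTheta : (ZMod 3)⟦X⟧ := PowerSeries.mk fun d ↦ (#(signedRoots d) : ZMod 3)

lemma coeff_signedTheta_eq {d n : ℕ} (h : d ≤ n) :
    coeff d signedTheta =
      coeff d (1 + 2 * ∑ j ∈ range n, (-1 : (ZMod 3)⟦X⟧) ^ (j + 1) * X ^ ((j + 1) ^ 2)) := by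
  have hc (j : ℕ) : coeff d ((-1 : (ZMod 3)⟦X⟧) ^ (j + 1) * X ^ ((j + 1) ^ 2)) =
      if d = (j + 1) ^ 2 then (-1) ^ (j + 1) else 0 := by
    have hC : (-1 : (ZMod 3)⟦X⟧) ^ (j + 1) = C ((-1) ^ (j + 1)) := by
      rw [map_pow, map_neg, map_one]
    rw [hC, coeff_C_mul, coeff_X_pow]
    simp
  rw [signedTheta, coeff_mk, map_add, show (2 : (ZMod 3)⟦X⟧) = C 2 from (map_ofNat C 2).symm,
    coeff_C_mul, map_sum]
  simp_rw [hc]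
  rw [coeff_one]
  by_cases hd : ∃ m, d = m ^ 2
  · obtain ⟨m, rfl⟩ := hd
    cases m with
    | zero =>
      have : signedRoots (0 ^ 2) = {0} := by
        ext k
        simp only [mem_signedRoots, mem_singleton]
        constructor
        · rintro ⟨h, -⟩
          simpa using h
        · rintro rfl
          simp
      rw [this]
      rw [sum_eq_zero]
      · simp
      · intro j _
        rw [if_neg]
        positivity
    | succ m =>
      rw [card_signedRoots_sq, sum_eq_single m]
      · simp
      · intro j _ hj
        rw [if_neg]
        intro h
        exact hj (by simpa using (Nat.pow_left_injective (n := 2) (by norm_num) h).symm)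
      · intro hm
        exact absurd (mem_range.mpr (by nlinarith)) hm
  · have : signedRoots d = ∅ := by
      ext k
      simp only [mem_signedRoots, notMem_empty, iff_false, not_and]
      intro hk
      exact absurd ⟨k.natAbs, by zify; rw [sq_abs, hk]⟩ hd
    rw [this, sum_eq_zero, if_neg]
    · simp
    · rintro rfl
      exact hd ⟨0, rfl⟩
    · exact fun j _ ↦ if_neg fun h ↦ hd ⟨_, h⟩

lemma signedTheta_pow_three :
    signedTheta ^ 3 = PowerSeries.expand 3 (by norm_num) signedTheta := by
  have : Fact (Nat.Prime 3) := ⟨by norm_num⟩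
  have h := MvPowerSeries.map_frobenius_expand 3 (by norm_num) (f := signedTheta)
  rw [ZMod.frobenius_zmod] at h
  rw [← h]
  simp [PowerSeries.expand]

lemma natCard_pairs_eq (n : ℕ) :
    Nat.card {p : ℤ × ℤ // (n : ℤ) = p.1 ^ 2 + 3 * p.2 ^ 2 ∧
        (Odd p.1 → 0 < p.1) ∧ (Odd p.2 → 0 < p.2)} =
      ∑ q ∈ antidiagonal n, #(signedRoots q.1) * if 3 ∣ q.2 then #(signedRoots (q.2 / 3)) else 0 := by
  have hmaps (p : ℤ × ℤ) : p ∈ (antidiagonal n).biUnion (fun q ↦ signedRoots q.1 ×ˢ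
      if 3 ∣ q.2 then signedRoots (q.2 / 3) else ∅) ↔ (n : ℤ) = p.1 ^ 2 + 3 * p.2 ^ 2 ∧
        (Odd p.1 → 0 < p.1) ∧ (Odd p.2 → 0 < p.2) := by
    simp only [mem_biUnion, mem_product, HasAntidiagonal.mem_antidiagonal]
    constructor
    · rintro ⟨⟨a, b⟩, hab, h1, h2⟩
      split_ifs at h2 with h3
      · obtain ⟨c, rfl⟩ := h3
        rw [Nat.mul_div_cancel_left _ (by norm_num)] at h2
        rw [mem_signedRoots] at h1 h2
        refine ⟨?_, h1.2, h2.2⟩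
        rw [h1.1, h2.1]
        exact_mod_cast hab.symm
      · simp at h2
    · rintro ⟨h, h1, h2⟩
      refine ⟨(p.1.natAbs ^ 2, 3 * p.2.natAbs ^ 2), ?_, ?_, ?_⟩
      · zify
        simp [h]
      · simpa [mem_signedRoots] using h1
      · simpa [mem_signedRoots] using h2
  rw [Nat.subtype_card _ hmaps, card_biUnion]
  · refine sum_congr rfl fun q _ ↦ ?_
    rw [card_product]
    split_ifs <;> simp
  · intro q hq r hr hqr
    rw [Function.onFun, disjoint_left]
    intro p hp hp'
    apply hqr
    simp only [mem_product, mem_signedRoots] at hp hp'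
    have h1 : q.1 = r.1 := by
      have := hp.1.1.symm.trans hp'.1.1
      exact_mod_cast this
    rw [mem_coe, HasAntidiagonal.mem_antidiagonal] at hq hr
    ext <;> omega

lemma coeff_signedTheta_pow_four (n : ℕ) :
    coeff n (signedTheta ^ 4) = (Nat.card {p : ℤ × ℤ // (n : ℤ) = p.1 ^ 2 + 3 * p.2 ^ 2 ∧
        (Odd p.1 → 0 < p.1) ∧ (Odd p.2 → 0 < p.2)} : ZMod 3) := by
  rw [natCard_pairs_eq, pow_succ', signedTheta_pow_three, coeff_mul]
  push_cast
  refine sum_congr rfl fun q _ ↦ ?_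
  rw [coeff_expand]
  simp [signedTheta]

/-- The weight of a part of size `i` and multiplicity `c` in the count `PD 3`. -/
def pdWeight (i c : ℕ) : ZMod 3 := if 3 ∣ i then 0 else c

lemma coeff_genFun_pdWeight (n : ℕ) :
    coeff n (Nat.Partition.genFun pdWeight) = (PD 3 n : ZMod 3) := by
  rw [Nat.Partition.coeff_genFun, PD]
  push_cast
  refine sum_congr rfl fun p _ ↦ ?_
  rw [Finsupp.prod, Multiset.toFinsupp_support]
  simp only [Multiset.toFinsupp_apply, pdWeight]
  split_ifs with h
  · exact prod_congr rfl fun s hs ↦ if_neg (h s (Multiset.mem_toFinset.mp hs))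
  · push Not at h
    obtain ⟨s, hs, h3⟩ := h
    exact prod_eq_zero (Multiset.mem_toFinset.mpr hs) (if_pos h3)

lemma three_eq_zero : (3 : (ZMod 3)⟦X⟧) = 0 := by
  have : (3 : (ZMod 3)⟦X⟧) = C 3 := (map_ofNat C 3).symm
  rw [this, show (3 : ZMod 3) = 0 from by decide, map_zero]

/-- Multiplying `1 + ∑ c y ^ c` by `(1 - y) ^ 2` gives `1 - y + y ^ 2 = (1 + y) ^ 2` mod 3. -/
lemma one_add_tsum_mul (i : ℕ) (hi : ¬ 3 ∣ i + 1) :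
    (1 + ∑' j, pdWeight (i + 1) (j + 1) • (X : (ZMod 3)⟦X⟧) ^ ((i + 1) * (j + 1))) *
      (1 - X ^ (i + 1)) ^ 2 = (1 + X ^ (i + 1)) ^ 2 := by
  set y : (ZMod 3)⟦X⟧ := X ^ (i + 1) with hy
  have hy0 : constantCoeff y = 0 := by simp [hy]
  have hsum := Nat.Partition.summable_genFun_term pdWeight i
  set T := ∑' j, pdWeight (i + 1) (j + 1) • (X : (ZMod 3)⟦X⟧) ^ ((i + 1) * (j + 1)) with hT
  have hterm (j : ℕ) : pdWeight (i + 1) (j + 1) • (X : (ZMod 3)⟦X⟧) ^ ((i + 1) * (j + 1)) =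
      ((j + 1 : ℕ) : (ZMod 3)⟦X⟧) * y ^ (j + 1) := by
    rw [pdWeight, if_neg hi, smul_eq_C_mul, hy, ← pow_mul]
    simp
  simp_rw [hterm] at hsum hT
  have hgeom := WithPiTopology.summable_pow_of_constantCoeff_eq_zero hy0
  have hG : (∑' j, y ^ j) * (1 - y) = 1 :=
    WithPiTopology.tsum_pow_mul_one_sub_of_constantCoeff_eq_zero hy0
  have hstep : T = y + (y * T + y * (y * ∑' j, y ^ j)) := by
    conv_lhs => rw [hT, hsum.tsum_eq_zero_add]
    rw [hT, ← hgeom.tsum_mul_left, ← hsum.tsum_mul_left, ← (hgeom.mul_left y).tsum_mul_left,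
      ← (hsum.mul_left y).tsum_add ((hgeom.mul_left y).mul_left y)]
    congr 1
    · simp
    · refine tsum_congr fun j ↦ ?_
      push_cast
      ring
  linear_combination (1 - y) * hstep + y ^ 2 * hG - y * three_eq_zero

/-- Mod 3, the product `∏ ((1 + X ^ i) / (1 - X ^ i)) ^ 2` over `i` prime to 3 is `(O / E) ^ 2`
divided by its cube, where `E = ∏ (1 - X ^ i)`, `O = ∏ (1 + X ^ i)` and `E / O = signedTheta`. -/
theorem genFun_pdWeight_eq : Nat.Partition.genFun pdWeight = signedTheta ^ 4 := by
  have : Fact (Nat.Prime 3) := ⟨by norm_num⟩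
  have hE := (WithPiTopology.multipliable_one_sub_X_pow (ZMod 3)).hasProd
  have hO : Multipliable fun i ↦ 1 + (X : (ZMod 3)⟦X⟧) ^ (i + 1) := by
    simpa using (Nat.Partition.hasProd_powerSeriesMk_card_countRestricted (ZMod 3) (m := 2)
      (by norm_num)).multipliable.congr fun i ↦ by simp [sum_range_succ]
  replace hO := hO.hasProd
  have hA := Nat.Partition.hasProd_genFun pdWeight
  set E := ∏' i, (1 - (X : (ZMod 3)⟦X⟧) ^ (i + 1))
  set O := ∏' i, (1 + (X : (ZMod 3)⟦X⟧) ^ (i + 1))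
  set G := Nat.Partition.genFun pdWeight
  have hinj : Function.Injective fun i : ℕ ↦ 3 * i + 2 := fun a b h ↦ by simpa using h
  have hmultiples {f : ℕ → (ZMod 3)⟦X⟧} {a : (ZMod 3)⟦X⟧} (hf : HasProd f a)
      (hcube : ∀ i, f (3 * i + 2) = f i ^ 3) :
      HasProd (fun i ↦ if 3 ∣ i + 1 then f i else 1) (a ^ 3) := by
    rw [← hinj.hasProd_iff]
    · convert hf.mul (hf.mul hf) using 1
      · ext1 i
        rw [Function.comp_apply, if_pos (by omega), hcube]
        ring
      · ring
    · intro i hi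
      rw [if_neg]
      rintro ⟨c, hc⟩
      exact hi ⟨c - 1, by simp; omega⟩
  have hcubeE (i : ℕ) : 1 - (X : (ZMod 3)⟦X⟧) ^ (3 * i + 2 + 1) = (1 - X ^ (i + 1)) ^ 3 := by
    linear_combination (X ^ (i + 1) - X ^ (2 * i + 2)) * three_eq_zero
  have hcubeO (i : ℕ) : 1 + (X : (ZMod 3)⟦X⟧) ^ (3 * i + 2 + 1) = (1 + X ^ (i + 1)) ^ 3 := by
    linear_combination -(X ^ (i + 1) + X ^ (2 * i + 2)) * three_eq_zero
  have hE3 := hmultiples hE hcubeE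
  have hO3 := hmultiples hO hcubeO
  have hL := (hA.mul (hE.mul hE)).mul (hO3.mul hO3)
  have hR := (hO.mul hO).mul (hE3.mul hE3)
  have key : G * (E * E) * (O ^ 3 * O ^ 3) = O * O * (E ^ 3 * E ^ 3) := by
    refine hL.unique (hR.congr_fun fun i ↦ ?_)
    split_ifs with h
    · have : pdWeight (i + 1) = 0 := by
        ext c
        exact if_pos h
      simp [this]
      ring
    · linear_combination one_add_tsum_mul i h
  have hgauss : signedTheta * O = E := gauss_mul_eq hE hO fun d n h ↦ coeff_signedTheta_eq h
  have hE0 : E ≠ 0 := WithPiTopology.tprod_one_sub_X_pow_ne_zero (ZMod 3)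
  have hO0 : O ≠ 0 := by
    intro h
    exact hE0 (by rw [← hgauss, h, mul_zero])
  apply mul_right_cancel₀ (mul_ne_zero (pow_ne_zero 2 hE0) (pow_ne_zero 6 hO0))
  rw [← hgauss] at key ⊢
  linear_combination key

theorem stmt_14 (n : ℕ) :
    PD 3 n ≡
      Nat.card {p : ℤ × ℤ //
        (n : ℤ) = p.1 ^ 2 + 3 * p.2 ^ 2 ∧
        (Odd p.1 → 0 < p.1) ∧ (Odd p.2 → 0 < p.2)} [MOD 3] := by
  rw [← ZMod.natCast_eq_natCast_iff, ← coeff_genFun_pdWeight, genFun_pdWeight_eq,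
    coeff_signedTheta_pow_four]
end

section
/- For all integers n ≥ 1, PD_3(2n) ≡ 0 (mod 3); for all integers n ≥ 0 and all ℓ ≥ 3, PD_{3^ℓ}(27n + 9) ≡ 0 (mod 3); and for all integers n ≥ 0 and all ℓ ≥ 1 with ℓ ≠ 2, PD_{3^ℓ}(27n + 18) ≡ 0 (mod 3). -/
open Finset

section FiniteGauss
variable {R : Type*} [CommRing R]

/-- The partial theta sum `∑_{|x| ≤ n} (-1) ^ x * q ^ (x ^ 2)`. -/
noncomputable def thetaSum (q : R) (n : ℕ) : R :=
  ∑ x ∈ Icc (-n : ℤ) n, (-1) ^ x.natAbs * q ^ (x.natAbs ^ 2)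

theorem thetaSum_succ (q : R) (n : ℕ) :
    thetaSum q (n + 1) = thetaSum q n + 2 * (-1) ^ (n + 1) * q ^ ((n + 1) ^ 2) := by
  have h : Icc (-(n + 1 : ℕ) : ℤ) (n + 1 : ℕ) =
      insert (-(n + 1 : ℕ) : ℤ) (insert ((n + 1 : ℕ) : ℤ) (Icc (-n : ℤ) n)) := by
    ext x
    simp only [mem_insert, mem_Icc]
    omega
  rw [thetaSum, h, sum_insert, sum_insert, Int.natAbs_neg, Int.natAbs_natCast, thetaSum]
  · ring
  · simp
  · simp only [mem_insert, mem_Icc]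
    omega

theorem gauss_telescope_s17 (q : R) (n m : ℕ) (hm : m ≤ n) :
    ∑ k ∈ range (m + 1), (-1) ^ k * (q ^ (k * (n + 2)) * ∏ i ∈ Ico k (n + 1), (1 - q ^ (i + 1)) -
        (1 + q ^ (n + 1)) * (q ^ (k * (n + 1)) * ∏ i ∈ Ico k n, (1 - q ^ (i + 1)))) *
        ∏ i ∈ range k, (1 + q ^ i) =
      (-1) ^ (m + 1) * q ^ ((m + 1) * (n + 1)) * (∏ i ∈ range (m + 1), (1 + q ^ i)) *
        ∏ i ∈ Ico m n, (1 - q ^ (i + 1)) := by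
  induction m with
  | zero =>
    simp only [zero_add, sum_range_one, prod_range_one, range_zero, prod_empty]
    rw [prod_Ico_succ_top (by omega)]
    ring
  | succ m ih =>
    rw [sum_range_succ, ih (by omega), prod_Ico_succ_top (by omega),
      prod_eq_prod_Ico_succ_bot (show m < n by omega), prod_range_succ _ (m + 1)]
    ring

/-- A finite form of Gauss's identity. -/
theorem sum_gauss (q : R) (n : ℕ) :
    ∑ k ∈ range (n + 1), (-1) ^ k * q ^ (k * (n + 1)) * (∏ i ∈ range k, (1 + q ^ i)) *
        ∏ i ∈ Ico k n, (1 - q ^ (i + 1)) =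
      (∏ i ∈ range n, (1 + q ^ (i + 1))) * thetaSum q n := by
  induction n with
  | zero => simp [thetaSum]
  | succ n ih =>
    have h := gauss_telescope_s17 q n n le_rfl
    have h2 : ∏ i ∈ range (n + 1), (1 + q ^ i) = 2 * ∏ i ∈ range n, (1 + q ^ (i + 1)) := by
      rw [prod_range_succ']
      norm_num
      ring
    have h3 : ∑ k ∈ range (n + 1), (-1) ^ k * (q ^ (k * (n + 2)) *
        ∏ i ∈ Ico k (n + 1), (1 - q ^ (i + 1)) -
        (1 + q ^ (n + 1)) * (q ^ (k * (n + 1)) * ∏ i ∈ Ico k n, (1 - q ^ (i + 1)))) *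
        ∏ i ∈ range k, (1 + q ^ i) =
        ∑ k ∈ range (n + 1), (-1) ^ k * q ^ (k * (n + 1 + 1)) * (∏ i ∈ range k, (1 + q ^ i)) *
          ∏ i ∈ Ico k (n + 1), (1 - q ^ (i + 1)) -
        (1 + q ^ (n + 1)) * ((∏ i ∈ range n, (1 + q ^ (i + 1))) * thetaSum q n) := by
      rw [← ih, mul_sum, ← sum_sub_distrib]
      exact sum_congr rfl fun k _ ↦ by ring
    rw [h3, h2, sub_eq_iff_eq_add] at h
    rw [sum_range_succ, h, thetaSum_succ, h2, prod_range_succ _ n]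
    simp only [Ico_self, prod_empty]
    ring

theorem pow_dvd_prod_mul_thetaSum_sub (q : R) (n : ℕ) :
    q ^ (n + 1) ∣ (∏ i ∈ range n, (1 + q ^ (i + 1))) * thetaSum q n -
      ∏ i ∈ range n, (1 - q ^ (i + 1)) := by
  rw [← sum_gauss, sum_range_succ']
  simp only [pow_zero, zero_mul, range_zero, prod_empty, one_mul, Nat.Ico_zero_eq_range,
    add_sub_cancel_right]
  refine dvd_sum fun k _ ↦ Dvd.dvd.mul_right (Dvd.dvd.mul_right (Dvd.dvd.mul_left ?_ _) _) _
  exact pow_dvd_pow q (Nat.le_mul_of_pos_left _ k.succ_pos)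

end FiniteGauss

open PowerSeries
open scoped PowerSeries.WithPiTopology

section ThetaSeries

/-- The number of integer square roots of `n`. -/
noncomputable def sqrtCount (n : ℕ) : ℕ := #{x ∈ Icc (-n : ℤ) n | x.natAbs ^ 2 = n}

theorem sqrtCount_eq_card {n N : ℕ} (h : n ≤ N) :
    sqrtCount n = #{x ∈ Icc (-N : ℤ) N | x.natAbs ^ 2 = n} := by
  rw [sqrtCount]
  congr 1
  ext x
  simp only [mem_filter, mem_Icc]
  refine and_congr_left fun hx ↦ ?_
  have : x.natAbs ≤ n := hx ▸ Nat.le_self_pow two_ne_zero _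
  omega

theorem sqrtCount_eq_zero {n : ℕ} (h : ∀ x : ℕ, x ^ 2 ≠ n) : sqrtCount n = 0 := by
  simp [sqrtCount, h]

theorem sqrtCount_nine_mul (n : ℕ) : sqrtCount (9 * n) = sqrtCount n := by
  refine (card_bij (fun x _ ↦ 3 * x) ?_ (by simp) ?_).symm
  · intro x
    simp only [mem_filter, mem_Icc, Int.natAbs_mul]
    rintro ⟨h, h'⟩
    refine ⟨by omega, ?_⟩
    rw [← h']
    norm_num
    ring
  · intro x
    simp only [mem_filter, mem_Icc]
    rintro ⟨h, h'⟩
    have h3 : 3 ∣ x.natAbs := Nat.prime_three.dvd_of_dvd_pow (n := 2) ⟨3 * n, by rw [h']; ring⟩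
    obtain ⟨y, rfl⟩ : (3 : ℤ) ∣ x := by omega
    have hy : y.natAbs ^ 2 = n := by
      simp only [Int.natAbs_mul] at h'
      norm_num at h'
      nlinarith
    have := hy ▸ Nat.le_self_pow two_ne_zero y.natAbs
    exact ⟨y, ⟨by omega, hy⟩, rfl⟩

theorem sqrtCount_eq_zero_of_mod_three {n : ℕ} (h : n % 3 = 2) : sqrtCount n = 0 := by
  refine sqrtCount_eq_zero fun x hx ↦ ?_
  have : x % 3 = 0 ∨ x % 3 = 1 ∨ x % 3 = 2 := by omega
  rcases this with h' | h' | h' <;> simp [← hx, Nat.pow_mod, h'] at h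

theorem sqrtCount_eq_zero_of_not_nine_dvd {n : ℕ} (h : n % 3 = 0) (h9 : ¬ 9 ∣ n) :
    sqrtCount n = 0 := by
  refine sqrtCount_eq_zero fun x hx ↦ h9 ?_
  obtain ⟨y, rfl⟩ := Nat.prime_three.dvd_of_dvd_pow (hx ▸ Nat.dvd_of_mod_eq_zero h)
  exact ⟨y ^ 2, by rw [← hx]; ring⟩

/-- The series `∑ (-1) ^ x * X ^ (x ^ 2)` over all integers `x`. -/
noncomputable def thetaSeries (R : Type*) [CommRing R] : R⟦X⟧ :=
  .mk fun n ↦ (-1) ^ n * (sqrtCount n : R)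

theorem coeff_thetaSum_X {R : Type*} [CommRing R] {n N : ℕ} (h : n ≤ N) :
    coeff n (thetaSum (X : R⟦X⟧) N) = coeff n (thetaSeries R) := by
  rw [thetaSum, thetaSeries, coeff_mk, sqrtCount_eq_card h, map_sum, card_filter]
  push_cast
  rw [mul_sum]
  refine sum_congr rfl fun x _ ↦ ?_
  have : ((-1) ^ x.natAbs : R⟦X⟧) = C ((-1) ^ x.natAbs) := by simp
  rw [this, coeff_C_mul, coeff_X_pow]
  by_cases hx : x.natAbs ^ 2 = n
  · rw [if_pos hx, if_pos hx.symm, ← hx, pow_two, pow_mul]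
    rcases Nat.even_or_odd x.natAbs with he | ho
    · simp [he.neg_one_pow]
    · simp [ho.neg_one_pow]
  · rw [if_neg hx, if_neg (Ne.symm hx)]
    simp

variable (R : Type*) [CommRing R] [TopologicalSpace R]

theorem tendsto_thetaSum_X :
    Filter.Tendsto (thetaSum (X : R⟦X⟧)) Filter.atTop (nhds (thetaSeries R)) := by
  rw [WithPiTopology.tendsto_iff_coeff_tendsto]
  exact fun d ↦ tendsto_atTop_of_eventually_const fun i (hi : i ≥ d) ↦ coeff_thetaSum_X hi

theorem multipliable_one_add_X_pow : Multipliable fun n ↦ (1 : R⟦X⟧) + X ^ (n + 1) := by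
  nontriviality R
  apply WithPiTopology.multipliable_one_add_of_tendsto_order_atTop_nhds_top
  simp_rw [order_X_pow]
  exact ENat.tendsto_natCast_nhds_top.comp (Filter.tendsto_add_atTop_nat _)

/-- Gauss's identity. -/
theorem tprod_mul_thetaSeries [IsTopologicalRing R] [T2Space R] :
    (∏' n, (1 + X ^ (n + 1) : R⟦X⟧)) * thetaSeries R = ∏' n, (1 - X ^ (n + 1) : R⟦X⟧) := by
  have h := ((multipliable_one_add_X_pow R).hasProd.tendsto_prod_nat.mul
    (tendsto_thetaSum_X R)).sub
    (WithPiTopology.multipliable_one_sub_X_pow R).hasProd.tendsto_prod_nat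
  rw [← sub_eq_zero]
  refine tendsto_nhds_unique h ?_
  rw [WithPiTopology.tendsto_iff_coeff_tendsto]
  refine fun d ↦ tendsto_atTop_of_eventually_const fun i (hi : i ≥ d) ↦ ?_
  rw [map_zero]
  exact X_pow_dvd_iff.1 (pow_dvd_prod_mul_thetaSum_sub X i) d (by omega)

end ThetaSeries

section GeneratingFunction

variable {R : Type*} [CommRing R]

/-- The generating function of `PD k`. -/
theorem mk_PD_eq_genFun (k : ℕ) :
    PowerSeries.mk (fun n ↦ (PD k n : R)) =
      Nat.Partition.genFun fun i c ↦ if k ∣ i then 0 else (c : R) := by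
  ext n
  rw [coeff_mk, Nat.Partition.coeff_genFun, PD, Nat.cast_sum]
  refine sum_congr rfl fun p _ ↦ ?_
  rw [Finsupp.prod, Multiset.toFinsupp_support]
  simp only [Multiset.toFinsupp_apply]
  split_ifs with h
  · push_cast
    exact prod_congr rfl fun s hs ↦ (if_neg (h s (Multiset.mem_toFinset.1 hs))).symm
  · push Not at h
    obtain ⟨s, hs, hk⟩ := h
    rw [Nat.cast_zero]
    exact (prod_eq_zero (i := s) (Multiset.mem_toFinset.2 hs) (by rw [if_pos hk])).symm

theorem sum_succ_mul_pow_mul_sq (y : R) (n : ℕ) :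
    (∑ j ∈ range n, (j + 1 : R) * y ^ (j + 1)) * (1 - y) ^ 2 =
      y - y ^ (n + 1) * (1 + n * (1 - y)) := by
  induction n with
  | zero => simp
  | succ n ih =>
    rw [sum_range_succ, add_mul, ih]
    push_cast
    ring

variable [TopologicalSpace R] [IsTopologicalRing R] [T2Space R]

theorem tsum_succ_smul_X_pow_mul_sq (i : ℕ) :
    (∑' j : ℕ, ((j + 1 : ℕ) : R) • (X : R⟦X⟧) ^ ((i + 1) * (j + 1))) * (1 - X ^ (i + 1)) ^ 2 =
      X ^ (i + 1) := by
  have h := (Nat.Partition.summable_genFun_term (fun _ c ↦ (c : R)) i).hasSum.tendsto_sum_nat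
  refine tendsto_nhds_unique (h.mul_const ((1 - X ^ (i + 1)) ^ 2)) ?_
  have h' (n : ℕ) : ∑ j ∈ range n, ((j + 1 : ℕ) : R) • (X : R⟦X⟧) ^ ((i + 1) * (j + 1)) =
      ∑ j ∈ range n, (j + 1 : R⟦X⟧) * (X ^ (i + 1)) ^ (j + 1) := by
    refine sum_congr rfl fun j _ ↦ ?_
    rw [smul_eq_C_mul, pow_mul]
    simp
  simp_rw [h', sum_succ_mul_pow_mul_sq]
  rw [WithPiTopology.tendsto_iff_coeff_tendsto]
  refine fun d ↦ tendsto_atTop_of_eventually_const fun n (hn : n ≥ d) ↦ ?_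
  rw [map_sub, sub_eq_self, ← pow_mul]
  refine X_pow_dvd_iff.1 (Dvd.intro _ rfl) d ?_
  exact (Nat.lt_succ_of_le hn).trans_le (Nat.le_mul_of_pos_left _ i.succ_pos)

end GeneratingFunction

section ModThree

local notation "θ" => thetaSeries (ZMod 3)

theorem expand_eq_pow (p : ℕ) [Fact p.Prime] (hp : p ≠ 0) (f : (ZMod p)⟦X⟧) :
    f.expand p hp = f ^ p := by
  have h := MvPowerSeries.map_frobenius_expand (R := ZMod p) p hp (f := f)
  rwa [ZMod.frobenius_zmod, MvPowerSeries.map_id] at h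

instance charP_powerSeries (R : Type*) [CommRing R] (p : ℕ) [CharP R p] : CharP R⟦X⟧ p :=
  charP_of_injective_ringHom (C_injective (R := R)) p

theorem hasProd_mk_PD_mul_tprod_sq (k : ℕ) :
    HasProd (fun n ↦ if k ∣ n + 1 then (1 - X ^ (n + 1)) ^ 2 else (1 + X ^ (n + 1)) ^ 2)
      (PowerSeries.mk (fun n ↦ (PD k n : ZMod 3)) * (∏' n, (1 - X ^ (n + 1))) ^ 2) := by
  rw [mk_PD_eq_genFun]
  have h := (Nat.Partition.hasProd_genFun fun i c ↦ if k ∣ i then 0 else (c : ZMod 3)).mul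
    ((WithPiTopology.multipliable_one_sub_X_pow (ZMod 3)).hasProd.map
      (powMonoidHom 2) (continuous_pow 2))
  refine h.congr_fun fun i ↦ ?_
  simp only [Function.comp_apply, powMonoidHom_apply]
  split_ifs with hk
  · simp
  · rw [add_mul, tsum_succ_smul_X_pow_mul_sq]
    have : (3 : (ZMod 3)⟦X⟧) = 0 := CharP.cast_eq_zero _ 3
    linear_combination X ^ (i + 1) * this

theorem hasProd_ite_dvd {ℓ : ℕ} {c P : (ZMod 3)⟦X⟧} (hc : c ^ 3 = c)
    (h : HasProd (fun n ↦ 1 + c * X ^ (n + 1)) P) :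
    HasProd (fun n ↦ if 3 ^ ℓ ∣ n + 1 then 1 + c * X ^ (n + 1) else 1) (P ^ 3 ^ ℓ) := by
  have hc' : c ^ 3 ^ ℓ = c := by
    induction ℓ with
    | zero => simp
    | succ ℓ ih => rw [pow_succ, pow_mul, ih, hc]
  have hpos : 0 < 3 ^ ℓ := by positivity
  have hg (n : ℕ) : 3 ^ ℓ * (n + 1) - 1 + 1 = 3 ^ ℓ * (n + 1) :=
    Nat.sub_add_cancel (Nat.mul_pos hpos n.succ_pos)
  have hinj : Function.Injective fun n ↦ 3 ^ ℓ * (n + 1) - 1 := fun a b hab ↦ by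
    have : 3 ^ ℓ * (a + 1) = 3 ^ ℓ * (b + 1) :=
      (hg a).symm.trans ((congrArg (· + 1) hab).trans (hg b))
    simpa using Nat.eq_of_mul_eq_mul_left hpos this
  rw [← hinj.hasProd_iff]
  · convert h.map (powMonoidHom (3 ^ ℓ)) (continuous_pow (3 ^ ℓ)) using 1
    swap
    · rfl
    ext1 n
    simp only [Function.comp_apply, powMonoidHom_apply, hg, dvd_mul_right, if_true]
    rw [add_pow_char_pow, one_pow, mul_pow, hc', ← pow_mul, mul_comm (n + 1)]
  · intro n hn
    refine if_neg fun ⟨m, hm⟩ ↦ hn ?_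
    obtain _ | m := m
    · simp at hm
    · exact ⟨m, by simp [← hm]⟩

theorem constantCoeff_thetaSeries (R : Type*) [CommRing R] :
    constantCoeff (thetaSeries R) = 1 := by
  rw [← coeff_zero_eq_constantCoeff_apply, ← coeff_thetaSum_X le_rfl]
  simp [thetaSum]

theorem thetaSeries_ne_zero : θ ≠ 0 := fun h ↦ by
  simpa [h] using constantCoeff_thetaSeries (ZMod 3)

theorem tprod_one_add_X_pow_ne_zero : ∏' n, (1 + X ^ (n + 1) : (ZMod 3)⟦X⟧) ≠ 0 := fun h ↦ by
  have := tprod_mul_thetaSeries (ZMod 3)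
  rw [h, zero_mul] at this
  exact WithPiTopology.tprod_one_sub_X_pow_ne_zero (ZMod 3) this.symm

theorem mk_PD_mul_thetaSeries_sq (ℓ : ℕ) :
    PowerSeries.mk (fun n ↦ (PD (3 ^ ℓ) n : ZMod 3)) * θ ^ 2 = θ ^ (2 * 3 ^ ℓ) := by
  have h := hasProd_mk_PD_mul_tprod_sq (3 ^ ℓ)
  set P := ∏' n, (1 + X ^ (n + 1) : (ZMod 3)⟦X⟧) with hP
  set Q := ∏' n, (1 - X ^ (n + 1) : (ZMod 3)⟦X⟧) with hQ
  have hC : HasProd (fun n ↦ (1 + X ^ (n + 1) : (ZMod 3)⟦X⟧)) P :=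
    (multipliable_one_add_X_pow (ZMod 3)).hasProd
  have hD : HasProd (fun n ↦ (1 - X ^ (n + 1) : (ZMod 3)⟦X⟧)) Q :=
    (WithPiTopology.multipliable_one_sub_X_pow (ZMod 3)).hasProd
  have hC' := hasProd_ite_dvd (ℓ := ℓ) (c := 1) (P := P) (by norm_num) (by simpa using hC)
  have hD' := hasProd_ite_dvd (ℓ := ℓ) (c := -1) (P := Q) (by norm_num)
    (by simpa [sub_eq_add_neg] using hD)
  have hPQ : P * θ = Q := tprod_mul_thetaSeries (ZMod 3)
  have hsq {f : ℕ → (ZMod 3)⟦X⟧} {a : (ZMod 3)⟦X⟧} (hf : HasProd f a) :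
      HasProd (fun n ↦ f n ^ 2) (a ^ 2) := hf.map (powMonoidHom 2) (continuous_pow 2)
  have hmul := (h.mul (hsq hC')).unique (((hsq hC).mul (hsq hD')).congr_fun fun n ↦ ?_)
  · rw [← hPQ] at hmul
    have h0 : P ^ 2 * (P ^ 3 ^ ℓ) ^ 2 ≠ 0 := by
      have := tprod_one_add_X_pow_ne_zero
      positivity
    refine mul_left_cancel₀ h0 ?_
    linear_combination hmul
  · split_ifs <;> ring

theorem mk_PD_eq_thetaSeries_pow (ℓ : ℕ) :
    PowerSeries.mk (fun n ↦ (PD (3 ^ ℓ) n : ZMod 3)) = θ ^ (2 * 3 ^ ℓ - 2) := by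
  refine mul_right_cancel₀ (pow_ne_zero 2 thetaSeries_ne_zero) ?_
  rw [mk_PD_mul_thetaSeries_sq, ← pow_add, Nat.sub_add_cancel]
  have : 0 < 3 ^ ℓ := by positivity
  omega

theorem PD_mod_three_eq_zero_iff (ℓ n : ℕ) :
    PD (3 ^ ℓ) n % 3 = 0 ↔ coeff n (θ ^ (2 * 3 ^ ℓ - 2)) = 0 := by
  rw [← mk_PD_eq_thetaSeries_pow, coeff_mk, ZMod.natCast_eq_zero_iff, Nat.dvd_iff_mod_eq_zero]

/-- The power series `∑ a (3 * n) * X ^ n` extracted from `∑ a n * X ^ n`. -/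
noncomputable def trisect (f : (ZMod 3)⟦X⟧) : (ZMod 3)⟦X⟧ := .mk fun n ↦ coeff (3 * n) f

theorem trisect_add (f g : (ZMod 3)⟦X⟧) : trisect (f + g) = trisect f + trisect g := by
  ext n
  simp [trisect]

theorem trisect_mul_pow_three (f g : (ZMod 3)⟦X⟧) : trisect (f * g ^ 3) = trisect f * g := by
  ext n
  rw [← expand_eq_pow 3 three_ne_zero, trisect, coeff_mk, coeff_mul, coeff_mul]
  refine (sum_of_injOn (fun p ↦ (3 * p.1, 3 * p.2)) ?_ ?_ ?_ ?_).symm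
  · intro p _ p' _ h
    simp only [Prod.mk.injEq] at h
    ext <;> omega
  · intro p hp
    simp only [mem_coe, HasAntidiagonal.mem_antidiagonal] at hp ⊢
    omega
  · rintro ⟨a, b⟩ hp hp'
    rw [coeff_expand_of_not_dvd, mul_zero]
    rintro ⟨c, rfl⟩
    rw [HasAntidiagonal.mem_antidiagonal] at hp
    refine hp' ⟨(n - c, c), ?_, ?_⟩
    · simp only [mem_coe, HasAntidiagonal.mem_antidiagonal] at hp ⊢
      omega
    · simp only [Prod.mk.injEq, and_true] at hp ⊢
      omega
  · intro p _
    simp [trisect]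

theorem trisect_pow_three (g : (ZMod 3)⟦X⟧) : trisect (g ^ 3) = g := by
  have h : trisect 1 = 1 := by
    ext n
    simp [trisect, coeff_one]
  simpa [h] using trisect_mul_pow_three 1 g

theorem coeff_thetaSeries_sub_pow_nine {n : ℕ} (h : n % 3 ≠ 1) : coeff n (θ - θ ^ 9) = 0 := by
  have h9 : θ ^ 9 = expand 3 three_ne_zero (expand 3 three_ne_zero θ) := by
    rw [expand_eq_pow, expand_eq_pow, ← pow_mul]
  rw [map_sub, sub_eq_zero, h9, ← expand_mul, coeff_expand, thetaSeries, coeff_mk]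
  split_ifs with h3
  · obtain ⟨m, rfl⟩ := h3
    rw [Nat.mul_div_cancel_left _ (by norm_num), coeff_mk, sqrtCount_nine_mul, pow_mul]
    norm_num
  · have : n % 3 = 0 ∨ n % 3 = 2 := by omega
    rcases this with h' | h'
    · rw [sqrtCount_eq_zero_of_not_nine_dvd h' h3, Nat.cast_zero, mul_zero]
    · rw [sqrtCount_eq_zero_of_mod_three h', Nat.cast_zero, mul_zero]

theorem trisect_thetaSeries_sub_pow_nine : trisect (θ - θ ^ 9) = 0 := by
  ext n
  rw [trisect, coeff_mk, coeff_thetaSeries_sub_pow_nine (by omega), map_zero]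

theorem trisect_thetaSeries_sub_pow_nine_sq : trisect ((θ - θ ^ 9) ^ 2) = 0 := by
  ext n
  rw [trisect, coeff_mk, pow_two, coeff_mul, map_zero]
  refine sum_eq_zero fun p hp ↦ ?_
  rw [HasAntidiagonal.mem_antidiagonal] at hp
  by_cases h : p.1 % 3 = 1
  · rw [coeff_thetaSeries_sub_pow_nine (n := p.2) (by omega), mul_zero]
  · rw [coeff_thetaSeries_sub_pow_nine h, zero_mul]

theorem trisect_thetaSeries : trisect θ = θ ^ 3 := by
  conv_lhs => rw [show θ = (θ - θ ^ 9) + (θ ^ 3) ^ 3 by ring]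
  rw [trisect_add, trisect_thetaSeries_sub_pow_nine, trisect_pow_three, zero_add]

theorem trisect_thetaSeries_sq : trisect (θ ^ 2) = θ ^ 6 := by
  conv_lhs => rw [show θ ^ 2 = (θ - θ ^ 9) ^ 2 + (θ - θ ^ 9) * (θ ^ 3) ^ 3 +
    (θ - θ ^ 9) * (θ ^ 3) ^ 3 + (θ ^ 6) ^ 3 by ring]
  simp only [trisect_add, trisect_mul_pow_three, trisect_thetaSeries_sub_pow_nine,
    trisect_thetaSeries_sub_pow_nine_sq, trisect_pow_three, zero_mul, zero_add]

theorem coeff_nine_mul (f : (ZMod 3)⟦X⟧) (n : ℕ) :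
    coeff (9 * n) f = coeff n (trisect (trisect f)) := by
  simp only [trisect, coeff_mk]
  congr 2
  ring

theorem trisect_trisect_thetaSeries_pow (m : ℕ) :
    trisect (trisect (θ ^ (18 * m + 16))) = θ ^ (2 * m + 8) := by
  rw [show θ ^ (18 * m + 16) = θ * (θ ^ (6 * m + 5)) ^ 3 by ring, trisect_mul_pow_three,
    trisect_thetaSeries, show θ ^ 3 * θ ^ (6 * m + 5) = θ ^ 2 * (θ ^ (2 * m + 2)) ^ 3 by ring,
    trisect_mul_pow_three, trisect_thetaSeries_sq]
  ring

theorem PD_nine_mul_mod_three {ℓ : ℕ} (hℓ : 3 ≤ ℓ) {n : ℕ} (hn : ¬ 3 ∣ n) :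
    PD (3 ^ ℓ) (9 * n) % 3 = 0 := by
  obtain ⟨m, rfl⟩ := Nat.exists_eq_add_of_le hℓ
  have hpos : 0 < 3 ^ m := by positivity
  have h : 2 * 3 ^ (3 + m) - 2 = 18 * (3 * 3 ^ m - 1) + 16 := by
    rw [pow_add]
    omega
  have h' : 2 * (3 * 3 ^ m - 1) + 8 = (2 * 3 ^ m + 2) * 3 := by omega
  rw [PD_mod_three_eq_zero_iff, coeff_nine_mul, h, trisect_trisect_thetaSeries_pow, h', pow_mul,
    ← expand_eq_pow 3 three_ne_zero, coeff_expand_of_not_dvd _ _ _ hn]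

theorem trisect_thetaSeries_pow_four : trisect (θ ^ 4) = θ ^ 4 := by
  rw [show θ ^ 4 = θ * θ ^ 3 by ring, trisect_mul_pow_three, trisect_thetaSeries]
  ring

theorem coeff_thetaSeries_pow_four (n : ℕ) :
    coeff n (θ ^ 4) = (-1) ^ n * ((∑ p ∈ antidiagonal n,
      if 3 ∣ p.2 then sqrtCount p.1 * sqrtCount (p.2 / 3) else 0 : ℕ) : ZMod 3) := by
  rw [pow_succ', ← expand_eq_pow 3 three_ne_zero, coeff_mul, Nat.cast_sum, mul_sum]
  refine sum_congr rfl fun p hp ↦ ?_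
  rw [coeff_expand, thetaSeries, coeff_mk]
  split_ifs with h
  · obtain ⟨c, hc⟩ := h
    rw [hc, Nat.mul_div_cancel_left _ three_pos, coeff_mk, ← HasAntidiagonal.mem_antidiagonal.1 hp, hc, pow_add,
      pow_mul]
    push_cast
    norm_num
    ring
  · simp

theorem coeff_thetaSeries_pow_four_eq_zero {n : ℕ} (h : n % 3 = 2) : coeff n (θ ^ 4) = 0 := by
  rw [coeff_thetaSeries_pow_four, sum_eq_zero, Nat.cast_zero, mul_zero]
  intro p hp
  rw [HasAntidiagonal.mem_antidiagonal] at hp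
  split_ifs with h3
  · rw [sqrtCount_eq_zero_of_mod_three (by omega), zero_mul]
  · rfl

/-- The integer solutions of `x ^ 2 + 3 * y ^ 2 = N`. -/
noncomputable def solutions (N : ℕ) : Finset (ℤ × ℤ) :=
  {z ∈ Icc (-N : ℤ) N ×ˢ Icc (-N : ℤ) N | z.1 ^ 2 + 3 * z.2 ^ 2 = (N : ℤ)}

theorem mem_solutions {N : ℕ} {z : ℤ × ℤ} : z ∈ solutions N ↔ z.1 ^ 2 + 3 * z.2 ^ 2 = (N : ℤ) := by
  simp only [solutions, mem_filter, mem_product, mem_Icc, and_iff_right_iff_imp]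
  intro h
  have h1 := Int.le_self_sq z.1
  have h2 := Int.le_self_sq (-z.1)
  have h3 := Int.le_self_sq z.2
  have h4 := Int.le_self_sq (-z.2)
  rw [neg_sq] at h2 h4
  have := sq_nonneg z.1
  have := sq_nonneg z.2
  omega

theorem sum_sqrtCount_eq_card (N : ℕ) :
    ∑ p ∈ antidiagonal N, (if 3 ∣ p.2 then sqrtCount p.1 * sqrtCount (p.2 / 3) else 0) =
      #(solutions N) := by
  rw [card_eq_sum_card_fiberwise (t := antidiagonal N)
    (f := fun z ↦ (z.1.natAbs ^ 2, 3 * z.2.natAbs ^ 2))]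
  · refine sum_congr rfl fun p hp ↦ ?_
    rw [HasAntidiagonal.mem_antidiagonal] at hp
    split_ifs with h
    · obtain ⟨c, hc⟩ := h
      rw [hc, Nat.mul_div_cancel_left _ three_pos, sqrtCount_eq_card (show p.1 ≤ N by omega),
        sqrtCount_eq_card (show c ≤ N by omega), ← card_product]
      congr 1
      ext ⟨x, y⟩
      simp only [solutions, mem_filter, mem_product, Prod.ext_iff, hc]
      constructor
      · rintro ⟨⟨hx, hx'⟩, hy, hy'⟩
        refine ⟨⟨⟨hx, hy⟩, ?_⟩, hx', by rw [hy']⟩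
        rw [← Int.natAbs_sq x, ← Int.natAbs_sq y]
        exact_mod_cast show x.natAbs ^ 2 + 3 * y.natAbs ^ 2 = N by rw [hx', hy']; omega
      · rintro ⟨⟨⟨hx, hy⟩, -⟩, hx', hy'⟩
        exact ⟨⟨hx, hx'⟩, hy, by omega⟩
    · refine (card_eq_zero.2 (filter_eq_empty_iff.2 fun z _ hz ↦ h ?_)).symm
      exact ⟨z.2.natAbs ^ 2, by rw [← hz]⟩
  · intro z hz
    rw [mem_coe, mem_solutions] at hz
    rw [mem_coe, HasAntidiagonal.mem_antidiagonal]
    zify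
    simpa using hz

theorem three_dvd_card_solutions {N : ℕ} (hN : 0 < N) (h2 : 2 ∣ N) :
    3 ∣ #(solutions N) := by
  have hpar {x y : ℤ} (hz : (x, y) ∈ solutions N) : ∃ w, x = y + 2 * w := by
    rw [mem_solutions] at hz
    have : Even (x ^ 2 + 3 * y ^ 2) := by
      rw [hz]
      exact_mod_cast even_iff_two_dvd.2 h2
    have : Even (x - y) := by
      have h3 : ¬ Even (3 : ℤ) := by decide
      simp only [Int.even_add, Int.even_sub, Int.even_mul, Int.even_pow, h3] at this ⊢
      tauto
    obtain ⟨w, hw⟩ := this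
    exact ⟨w, by omega⟩
  let f : Function.End (solutions N) :=
    fun z ↦ ⟨((-z.1.1 - 3 * z.1.2) / 2, (z.1.1 - z.1.2) / 2), by
      obtain ⟨⟨x, y⟩, hz⟩ := z
      obtain ⟨w, rfl⟩ := hpar hz
      rw [mem_solutions] at hz ⊢
      have h1 : (-(y + 2 * w) - 3 * y) / 2 = -w - 2 * y := by omega
      have h2 : (y + 2 * w - y) / 2 = w := by omega
      simp only [h1, h2]
      rw [← hz]
      ring⟩
  have hf : f ^ 3 ^ 1 = 1 := by
    funext z
    obtain ⟨⟨x, y⟩, hz⟩ := z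
    obtain ⟨w, rfl⟩ := hpar hz
    apply Subtype.ext
    change (f (f (f _))).1 = (y + 2 * w, y)
    simp only [f, Prod.mk.injEq]
    omega
  have hcard := Equiv.Perm.card_fixedPoints_modEq hf
  have hfix : f.fixedPoints = ∅ := by
    refine Set.eq_empty_iff_forall_notMem.2 fun z hz ↦ ?_
    obtain ⟨⟨x, y⟩, hz'⟩ := z
    obtain ⟨w, rfl⟩ := hpar hz'
    have := congrArg Subtype.val hz
    simp only [f, Prod.mk.injEq] at this
    have hy : y = 0 := by omega
    have hw : w = 0 := by omega
    rw [mem_solutions, hy, hw] at hz'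
    simp at hz'
    omega
  rw [Fintype.card_coe] at hcard
  simp only [hfix] at hcard
  simpa using (Nat.modEq_zero_iff_dvd.1 (by simpa using hcard))

theorem PD_three_even_mod_three {n : ℕ} (hn : 1 ≤ n) : PD 3 (2 * n) % 3 = 0 := by
  have h := (PD_mod_three_eq_zero_iff 1 (2 * n)).2
  norm_num at h
  apply h
  rw [coeff_thetaSeries_pow_four, sum_sqrtCount_eq_card,
    (ZMod.natCast_eq_zero_iff _ 3).2 (three_dvd_card_solutions (by omega) (by omega)), mul_zero]

theorem PD_three_nine_mul_mod_three {n : ℕ} (hn : n % 3 = 2) : PD 3 (9 * n) % 3 = 0 := by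
  have h := (PD_mod_three_eq_zero_iff 1 (9 * n)).2
  norm_num at h
  apply h
  rw [coeff_nine_mul, trisect_thetaSeries_pow_four, trisect_thetaSeries_pow_four,
    coeff_thetaSeries_pow_four_eq_zero hn]

end ModThree

theorem stmt_17 :
    (∀ n : ℕ, 1 ≤ n → PD 3 (2 * n) % 3 = 0) ∧
    (∀ n ℓ : ℕ, 3 ≤ ℓ → PD (3 ^ ℓ) (27 * n + 9) % 3 = 0) ∧
    (∀ n ℓ : ℕ, 1 ≤ ℓ → ℓ ≠ 2 → PD (3 ^ ℓ) (27 * n + 18) % 3 = 0) := by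
  refine ⟨fun n hn ↦ PD_three_even_mod_three hn, fun n ℓ hℓ ↦ ?_, fun n ℓ hℓ hℓ' ↦ ?_⟩
  · rw [show 27 * n + 9 = 9 * (3 * n + 1) by ring]
    exact PD_nine_mul_mod_three hℓ (by omega)
  · rw [show 27 * n + 18 = 9 * (3 * n + 2) by ring]
    obtain rfl | h : ℓ = 1 ∨ 3 ≤ ℓ := by omega
    · rw [pow_one]
      exact PD_three_nine_mul_mod_three (by omega)
    · exact PD_nine_mul_mod_three h (by omega)
end

section
/- For all integers n ≥ 0, k ≥ 1, and ℓ ≥ 2k + 1, both PD_{3^ℓ}(3^{2k}(3n + 1)) ≡ 0 (mod 3) and PD_{3^ℓ}(3^{2k}(3n + 2)) ≡ 0 (mod 3). -/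
section DesignatedSummands

open PowerSeries Finset Filter
open scoped PowerSeries.WithPiTopology

/-! ### The finite form, due to Shanks, of the Gauss identity -/

section Shanks

variable {S : Type*} [CommRing S]

theorem prod_Ioc_eq_mul_prod_Ioc_succ (g : ℕ → S) {m n : ℕ} (h : m < n) :
    ∏ i ∈ Ioc m n, g i = g (m + 1) * ∏ i ∈ Ioc (m + 1) n, g i := by
  rw [← insert_Ioc_succ_left_eq_Ioc h, prod_insert (by simp)]
  rfl

/-- With `r i` the inverse of `1 + q ^ i`, the terms of the Shanks sum for `n + 1` and for `n`
differ by a telescoping quantity. -/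
theorem sum_shanks_sub (q : S) (r : ℕ → S) (hr : ∀ i, r i * (1 + q ^ i) = 1) (n m : ℕ)
    (hm : m ≤ n) :
    ∑ s ∈ range (m + 1),
      (2 * (-1) ^ s * (∏ i ∈ Ioc s (n + 1), (1 - q ^ i) * r i) * q ^ (s * (n + 2)) * r s -
        2 * (-1) ^ s * (∏ i ∈ Ioc s n, (1 - q ^ i) * r i) * q ^ (s * (n + 1)) * r s) =
      -(2 * (-1) ^ m * (∏ i ∈ Ioc m n, (1 - q ^ i) * r i) * q ^ ((m + 1) * (n + 1)) *
        r (n + 1)) := by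
  induction m with
  | zero =>
    rw [sum_range_one, prod_Ioc_succ_top (by lia)]
    have h0 := hr 0
    have hN := hr (n + 1)
    simp only [pow_zero, zero_mul, zero_add, one_mul, mul_one] at h0 ⊢
    set D := ∏ i ∈ Ioc 0 n, (1 - q ^ i) * r i
    linear_combination D * ((1 - q ^ (n + 1)) * r (n + 1) - 1) * h0 + D * hN
  | succ m ih =>
    rw [sum_range_succ, ih (by lia), prod_Ioc_succ_top hm,
      prod_Ioc_eq_mul_prod_Ioc_succ _ (by lia : m < n)]
    have hM := hr (m + 1)
    have hN := hr (n + 1)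
    set D := ∏ i ∈ Ioc (m + 1) n, (1 - q ^ i) * r i
    rw [show (m + 1) * (n + 2) = (m + 1) * (n + 1) + (m + 1) by ring,
      show (m + 1 + 1) * (n + 1) = (m + 1) * (n + 1) + (n + 1) by ring,
      pow_add q ((m + 1) * (n + 1)), pow_add q ((m + 1) * (n + 1)), pow_succ (-1 : S) m]
    linear_combination 2 * (-1) ^ m * D * q ^ ((m + 1) * (n + 1)) *
      (q ^ (n + 1) * r (n + 1) * hM - r (m + 1) * hN)

theorem sum_neg_one_pow_mul_pow_sq_eq (q : S) (r : ℕ → S) (hr : ∀ i, r i * (1 + q ^ i) = 1)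
    (n : ℕ) :
    1 + 2 * ∑ s ∈ range n, (-1) ^ (s + 1) * q ^ (s + 1) ^ 2 =
      ∑ s ∈ range (n + 1),
        2 * (-1) ^ s * (∏ i ∈ Ioc s n, (1 - q ^ i) * r i) * q ^ (s * (n + 1)) * r s := by
  induction n with
  | zero =>
    have h0 := hr 0
    simp only [range_zero, sum_empty, zero_add, range_one, sum_singleton, Ioc_self, prod_empty,
      pow_zero, zero_mul] at h0 ⊢
    linear_combination -h0
  | succ n ih =>
    have h := sum_shanks_sub q r hr n n le_rfl
    have hN := hr (n + 1)
    rw [sum_sub_distrib, ← ih] at h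
    rw [sum_range_succ, sum_range_succ _ (n + 1)]
    simp only [Ioc_self, prod_empty] at h ⊢
    rw [show (n + 1) * (n + 1 + 1) = (n + 1) ^ 2 + (n + 1) by ring, pow_add q ((n + 1) ^ 2),
      pow_succ (-1 : S) n]
    rw [← sq (n + 1)] at h
    linear_combination 2 * (-1) ^ n * q ^ (n + 1) ^ 2 * hN - h

end Shanks

/-! ### The theta series `∑ (-1) ^ n X ^ (n ^ 2)` and the Gauss identity -/

/-- The theta series `∑_{j ∈ ℤ} (-1) ^ j X ^ (j ^ 2)` over `ZMod 3`. -/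
noncomputable def theta : (ZMod 3)⟦X⟧ :=
  PowerSeries.mk fun n ↦ (-1) ^ n * if n = 0 then 1 else if IsSquare n then 2 else 0

theorem coeff_theta (n : ℕ) :
    coeff n theta = (-1) ^ n * if n = 0 then 1 else if IsSquare n then 2 else 0 :=
  coeff_mk _ _

theorem isSquare_of_coeff_theta_ne_zero {n : ℕ} (h : coeff n theta ≠ 0) : IsSquare n := by
  rw [coeff_theta] at h
  by_contra hn
  have : n ≠ 0 := by rintro rfl; simp at hn
  simp [hn, this] at h

theorem constantCoeff_theta : constantCoeff theta = 1 := by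
  rw [← coeff_zero_eq_constantCoeff_apply, coeff_theta]
  simp

theorem theta_ne_zero : theta ≠ 0 := by
  intro h
  simpa [h] using constantCoeff_theta

theorem X_pow_dvd_theta_sub (n : ℕ) :
    (X : (ZMod 3)⟦X⟧) ^ (n + 1) ∣
      theta - (1 + 2 * ∑ s ∈ range n, (-1) ^ (s + 1) * X ^ (s + 1) ^ 2) := by
  rw [X_pow_dvd_iff]
  intro m hm
  have hc (s : ℕ) : coeff m ((-1 : (ZMod 3)⟦X⟧) ^ (s + 1) * X ^ (s + 1) ^ 2) =
      if m = (s + 1) ^ 2 then (-1) ^ (s + 1) else 0 := by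
    rw [show ((-1 : (ZMod 3)⟦X⟧) ^ (s + 1)) = C ((-1) ^ (s + 1)) by simp, coeff_C_mul, coeff_X_pow]
    simp
  rw [map_sub, coeff_theta, map_add, ← map_ofNat C 2, coeff_C_mul, map_sum,
    coeff_one, sub_eq_zero]
  simp only [hc]
  rcases eq_or_ne m 0 with rfl | h0
  · have (s : ℕ) : 0 ≠ (s + 1) ^ 2 := by positivity
    simp [this]
  by_cases hsq : IsSquare m
  · obtain ⟨t, rfl⟩ := hsq
    have ht : t ≠ 0 := by rintro rfl; simp at h0
    obtain ⟨t, rfl⟩ := Nat.exists_eq_succ_of_ne_zero ht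
    rw [sum_eq_single t]
    · have : (-1 : ZMod 3) ^ ((t + 1) * (t + 1)) = (-1) ^ (t + 1) := by
        rw [neg_one_pow_congr]
        simp [Nat.even_mul]
      simp [this, sq, mul_comm]
    · intro b _ hb
      rw [if_neg]
      rw [← sq]
      intro h
      exact hb (by have := Nat.pow_left_injective (n := 2) (by simp) h; simpa using this.symm)
    · intro h
      simp only [mem_range, Nat.succ_eq_add_one] at *
      nlinarith
  · have (s : ℕ) : m ≠ (s + 1) ^ 2 := by
      rintro rfl
      exact hsq (IsSquare.sq _)
    simp [h0, hsq, this]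

theorem X_pow_dvd_theta_mul_prod_sub_prod (n : ℕ) :
    (X : (ZMod 3)⟦X⟧) ^ (n + 1) ∣
      theta * ∏ i ∈ range n, (1 + X ^ (i + 1)) - ∏ i ∈ range n, (1 - X ^ (i + 1)) := by
  set r : ℕ → (ZMod 3)⟦X⟧ := fun i ↦ (1 + X ^ i)⁻¹
  have hr (i : ℕ) : r i * (1 + X ^ i) = 1 := by
    refine PowerSeries.inv_mul_cancel _ ?_
    rcases i with _ | i
    · simp only [pow_zero, map_add, map_one]
      decide
    · simp
  have h := sum_neg_one_pow_mul_pow_sq_eq X r hr n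
  have h0 := hr 0
  have hprod : (∏ i ∈ Ioc 0 n, (1 - X ^ i) * r i) * ∏ i ∈ range n, (1 + X ^ (i + 1)) =
      ∏ i ∈ range n, (1 - (X : (ZMod 3)⟦X⟧) ^ (i + 1)) := by
    rw [show Ioc 0 n = (range n).image (· + 1) by
      ext i
      simp only [mem_Ioc, mem_image, mem_range]
      exact ⟨fun hi ↦ ⟨i - 1, by lia⟩, by rintro ⟨a, ha, rfl⟩; lia⟩,
      prod_image (by simp), ← prod_mul_distrib]
    exact prod_congr rfl fun i _ ↦ by linear_combination (1 - X ^ (i + 1)) * hr (i + 1)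
  rw [sum_range_succ'] at h
  simp only [pow_zero, zero_mul, mul_one] at h
  obtain ⟨a, ha⟩ := X_pow_dvd_theta_sub n
  obtain ⟨b, hb⟩ : (X : (ZMod 3)⟦X⟧) ^ (n + 1) ∣ ∑ s ∈ range n, 2 * (-1) ^ (s + 1) *
      (∏ i ∈ Ioc (s + 1) n, (1 - X ^ i) * r i) * X ^ ((s + 1) * (n + 1)) * r (s + 1) :=
    dvd_sum fun s _ ↦ ((pow_dvd_pow X (by nlinarith)).mul_left _).mul_right _
  rw [h, hb] at ha
  refine ⟨(a + b) * ∏ i ∈ range n, (1 + X ^ (i + 1)), ?_⟩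
  rw [← hprod]
  set D := ∏ i ∈ Ioc 0 n, (1 - X ^ i) * r i
  set B := ∏ i ∈ range n, (1 + (X : (ZMod 3)⟦X⟧) ^ (i + 1))
  linear_combination B * ha + D * B * h0

theorem theta_mul_eq {A B : (ZMod 3)⟦X⟧}
    (hA : HasProd (fun i ↦ 1 - (X : (ZMod 3)⟦X⟧) ^ (i + 1)) A)
    (hB : HasProd (fun i ↦ 1 + (X : (ZMod 3)⟦X⟧) ^ (i + 1)) B) : theta * B = A := by
  refine tendsto_nhds_unique ((tendsto_const_nhds (x := theta)).mul hB.tendsto_prod_nat) ?_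
  have h := hA.tendsto_prod_nat
  rw [WithPiTopology.tendsto_iff_coeff_tendsto] at h ⊢
  intro d
  refine (h d).congr' ?_
  filter_upwards [eventually_ge_atTop d] with n hn
  have := X_pow_dvd_iff.mp (X_pow_dvd_theta_mul_prod_sub_prod n) d (by lia)
  rw [map_sub, sub_eq_zero] at this
  exact this.symm

/-! ### The generating function of `PD` modulo 3 -/

theorem pow_three_pow_eq_expand (f : (ZMod 3)⟦X⟧) (n : ℕ) :
    f ^ 3 ^ n = expand (3 ^ n) (by positivity) f := by
  have h := MvPowerSeries.map_iterateFrobenius_expand 3 (by simp) f n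
  have h1 : iterateFrobenius (ZMod 3) 3 n = RingHom.id _ := RingHom.ext_zmod _ _
  rw [h1, MvPowerSeries.map_id] at h
  exact h.symm

/-- The weight attached to a part size and its multiplicity. -/
def designatedWeight (k i c : ℕ) : ZMod 3 := if k ∣ i then 0 else c

theorem cast_PD (k n : ℕ) :
    (PD k n : ZMod 3) = coeff n (Nat.Partition.genFun (designatedWeight k)) := by
  rw [Nat.Partition.coeff_genFun, PD, Nat.cast_sum]
  refine sum_congr rfl fun p _ ↦ ?_
  simp only [Finsupp.prod, Multiset.toFinsupp_support, Multiset.toFinsupp_apply, designatedWeight]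
  split_ifs with h
  · rw [Nat.cast_prod]
    exact prod_congr rfl fun s hs ↦ (if_neg (h s (Multiset.mem_toFinset.mp hs))).symm
  · push Not at h
    obtain ⟨s, hs, hk⟩ := h
    rw [Nat.cast_zero]
    exact (prod_eq_zero (Multiset.mem_toFinset.mpr hs) (by simp [hk])).symm

theorem one_sub_sq_mul_tsum (i : ℕ) :
    (1 - (X : (ZMod 3)⟦X⟧) ^ (i + 1)) ^ 2 *
      (1 + ∑' j : ℕ, ((j + 1 : ℕ) : ZMod 3) • X ^ ((i + 1) * (j + 1))) =
      (1 + X ^ (i + 1)) ^ 2 := by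
  set x : (ZMod 3)⟦X⟧ := X ^ (i + 1) with hx
  have hx0 : constantCoeff x = 0 := by simp [hx]
  have hG := WithPiTopology.tsum_pow_mul_one_sub_of_constantCoeff_eq_zero hx0
  have hGs := WithPiTopology.summable_pow_of_constantCoeff_eq_zero hx0
  set G := ∑' j : ℕ, x ^ j
  have hterm (j : ℕ) : ((j + 1 : ℕ) : ZMod 3) • (X : (ZMod 3)⟦X⟧) ^ ((i + 1) * (j + 1)) =
      (j + 1) * x ^ (j + 1) := by
    rw [smul_eq_C_mul, pow_mul]
    simp [hx]
  have hs := Nat.Partition.summable_genFun_term (fun _ c ↦ (c : ZMod 3)) i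
  simp only [hterm] at hs ⊢
  have hS : ∑' j : ℕ, ((j : (ZMod 3)⟦X⟧) + 1) * x ^ (j + 1) =
      x + (x * ∑' j : ℕ, ((j : (ZMod 3)⟦X⟧) + 1) * x ^ (j + 1) + x ^ 2 * G) := by
    conv_lhs => rw [hs.tsum_eq_zero_add]
    rw [← hs.tsum_mul_left, ← hGs.tsum_mul_left, ← (hs.mul_left x).tsum_add (hGs.mul_left _)]
    congr 1
    · simp
    · refine tsum_congr fun j ↦ ?_
      push_cast
      ring
  set T := ∑' j : ℕ, ((j : (ZMod 3)⟦X⟧) + 1) * x ^ (j + 1)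
  have h3 : (3 : (ZMod 3)⟦X⟧) = 0 := by
    rw [← map_ofNat C 3, show (OfNat.ofNat 3 : ZMod 3) = 0 from rfl, map_zero]
  linear_combination (1 - x) * hS + x ^ 2 * hG - x * h3

theorem genFun_designatedWeight_mul_theta_cube (l : ℕ) :
    Nat.Partition.genFun (designatedWeight (3 ^ l)) * theta ^ 3 = theta * (theta ^ 3 ^ l) ^ 2 := by
  set k := 3 ^ l with hk
  have hk0 : 0 < k := by positivity
  obtain ⟨A, hA⟩ := WithPiTopology.multipliable_one_sub_X_pow (ZMod 3)
  obtain ⟨B, hB⟩ : Multipliable fun i ↦ 1 + (X : (ZMod 3)⟦X⟧) ^ (i + 1) := by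
    refine WithPiTopology.multipliable_one_add_of_tendsto_order_atTop_nhds_top _ ?_
    simp_rw [order_X_pow]
    exact ENat.tendsto_natCast_nhds_top.comp (tendsto_add_atTop_nat _)
  have hAB := theta_mul_eq hA hB
  have hinj : Function.Injective fun j ↦ k * (j + 1) - 1 := by
    intro a b h
    have ha : 0 < k * (a + 1) := by positivity
    have hb : 0 < k * (b + 1) := by positivity
    have : k * (a + 1) = k * (b + 1) := by simp only at h; lia
    simpa [hk0.ne'] using this
  have hsub (c : (ZMod 3)⟦X⟧ → (ZMod 3)⟦X⟧) (hc : ∀ j : ℕ, c (X ^ (k * j)) = c (X ^ j) ^ k)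
      {Z : (ZMod 3)⟦X⟧} (hZ : HasProd (fun i ↦ c (X ^ (i + 1))) Z) :
      HasProd (fun i ↦ if k ∣ i + 1 then c (X ^ (i + 1)) else 1) (Z ^ k) := by
    rw [← hinj.hasProd_iff]
    · convert hZ.pow k using 1
      funext j
      have : k * (j + 1) - 1 + 1 = k * (j + 1) := Nat.sub_add_cancel (by nlinarith)
      simp [this, hc]
    · intro i hi
      refine if_neg fun ⟨d, hd⟩ ↦ hi ⟨d - 1, ?_⟩
      have : d ≠ 0 := by rintro rfl; simp at hd
      simp only [Nat.sub_add_cancel (Nat.one_le_iff_ne_zero.mpr this), ← hd, Nat.add_sub_cancel]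
  have hA' := hsub (1 - ·) (fun j ↦ by
    rw [pow_three_pow_eq_expand]; simp [pow_mul, hk]) hA
  have hB' := hsub (1 + ·) (fun j ↦ by
    rw [pow_three_pow_eq_expand]; simp [pow_mul, hk]) hB
  have hF := Nat.Partition.hasProd_genFun (designatedWeight k)
  have h1 := ((hA.pow 2).mul (hB'.pow 2)).mul hF
  have h2 := (hB.pow 2).mul (hA'.pow 2)
  have h := h1.unique (h2.congr_fun ?_)
  swap
  · intro i
    have hi := one_sub_sq_mul_tsum i
    simp only [designatedWeight]
    split_ifs with hd
    · simp
      ring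
    · simpa using hi
  have hA0 : A ≠ 0 := by
    rw [← hA.tprod_eq]
    exact WithPiTopology.tprod_one_sub_X_pow_ne_zero _
  have hB0 : B ≠ 0 := by
    rintro rfl
    exact hA0 (by rw [← hAB, mul_zero])
  rw [← hAB, mul_pow, mul_pow theta B k] at h
  refine mul_left_cancel₀ (mul_ne_zero (pow_ne_zero 2 hB0) (pow_ne_zero 2 (pow_ne_zero k hB0))) ?_
  linear_combination theta * h

/-! ### Dissection modulo 3 -/

theorem coeff_mul_expand_eq_zero {R : Type*} [CommRing R] (p : ℕ) (hp : p ≠ 0) (f g : R⟦X⟧) (n : ℕ)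
    (h : ∀ i j, i + p * j = n → coeff i f = 0) : coeff n (f * expand p hp g) = 0 := by
  rw [coeff_mul]
  refine sum_eq_zero fun x hx ↦ ?_
  rw [coeff_expand]
  split_ifs with hd
  · obtain ⟨j, hj⟩ := hd
    rw [h x.1 j (by rw [← hj]; exact mem_antidiagonal.mp hx), zero_mul]
  · rw [mul_zero]

theorem coeff_three_mul_theta (n : ℕ) : coeff (3 * n) theta = coeff (3 * n) (theta ^ 9) := by
  rw [show 9 = 3 ^ 2 by rfl, pow_three_pow_eq_expand, coeff_expand]
  split_ifs with h
  · obtain ⟨m, hm⟩ := h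
    have hsq : IsSquare (3 ^ 2 * m) ↔ IsSquare m := by
      refine ⟨fun ⟨t, ht⟩ ↦ ?_, fun h ↦ (IsSquare.sq 3).mul h⟩
      obtain ⟨u, rfl⟩ : 3 ∣ t := (Nat.pow_dvd_pow_iff two_ne_zero).mp (Dvd.intro m (by lia))
      exact ⟨u, by nlinarith⟩
    rw [hm, Nat.mul_div_cancel_left _ (by simp), coeff_theta, coeff_theta]
    simp only [hsq]
    simp [pow_mul, Odd.neg_one_pow (show Odd 9 by decide)]
  · by_contra hne
    obtain ⟨t, ht⟩ := isSquare_of_coeff_theta_ne_zero hne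
    have h3 : 3 ∣ t := Nat.prime_three.dvd_of_dvd_pow (n := 2) (Dvd.intro n (by lia))
    exact h (by rw [ht, ← sq]; exact pow_dvd_pow_of_dvd h3 2)

theorem coeff_three_mul_genFun (l n : ℕ) :
    coeff (3 * n) (Nat.Partition.genFun (designatedWeight (3 ^ (l + 1)))) =
      coeff n (theta ^ 2 * expand (3 ^ l) (by positivity) (theta ^ 2)) := by
  have h := genFun_designatedWeight_mul_theta_cube (l + 1)
  have hinv := PowerSeries.mul_inv_cancel theta (by rw [constantCoeff_theta]; exact one_ne_zero)
  set F := Nat.Partition.genFun (designatedWeight (3 ^ (l + 1)))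
  rw [← pow_three_pow_eq_expand]
  set W := (theta ^ 2) ^ 3 ^ l with hW
  have hW3 : (theta ^ 3 ^ (l + 1)) ^ 2 = W ^ 3 := by
    rw [hW]
    ring
  have key : F = (theta ^ 2 * W) ^ 3 + (theta - theta ^ 9) * (W * theta⁻¹) ^ 3 := by
    refine mul_right_cancel₀ (pow_ne_zero 3 theta_ne_zero) ?_
    have hinv3 : theta ^ 3 * theta⁻¹ ^ 3 = 1 := by rw [← mul_pow, hinv, one_pow]
    rw [h, hW3]
    linear_combination -(theta - theta ^ 9) * W ^ 3 * hinv3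
  have hexp (f : (ZMod 3)⟦X⟧) : f ^ 3 = expand 3 three_ne_zero f := by
    simpa using pow_three_pow_eq_expand f 1
  rw [key, map_add, hexp, hexp (W * _), coeff_expand_mul, coeff_mul_expand_eq_zero, add_zero]
  intro i j hij
  obtain ⟨m, rfl⟩ : 3 ∣ i := by lia
  rw [map_sub, coeff_three_mul_theta, sub_self]

theorem coeff_theta_sq_eq_zero (n : ℕ) (h : ¬ ∃ x y, n = x ^ 2 + y ^ 2) :
    coeff n (theta ^ 2) = 0 := by
  rw [sq, coeff_mul]
  refine sum_eq_zero fun x hx ↦ ?_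
  by_contra hne
  obtain ⟨a, ha⟩ := isSquare_of_coeff_theta_ne_zero (left_ne_zero_of_mul hne)
  obtain ⟨b, hb⟩ := isSquare_of_coeff_theta_ne_zero (right_ne_zero_of_mul hne)
  exact h ⟨a, b, by rw [← mem_antidiagonal.mp hx, ha, hb, sq, sq]⟩

theorem three_pow_odd_mul_ne_sq_add_sq {e m : ℕ} (he : Odd e) (hm : ¬ 3 ∣ m) :
    ¬ ∃ x y, 3 ^ e * m = x ^ 2 + y ^ 2 := by
  rw [Nat.eq_sq_add_sq_iff]
  intro h
  have hm0 : m ≠ 0 := by rintro rfl; simp at hm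
  have h3 : 3 ∈ (3 ^ e * m).primeFactors :=
    Nat.mem_primeFactors.mpr
      ⟨Nat.prime_three, (dvd_pow_self 3 he.pos.ne').mul_right m, by positivity⟩
  have := h 3 h3 (by norm_num)
  rw [padicValNat.mul (by positivity) hm0, padicValNat.prime_pow,
    padicValNat.eq_zero_of_not_dvd hm, add_zero] at this
  exact Nat.not_even_iff_odd.mpr he this

theorem PD_three_pow_mod_three (k l m : ℕ) (hk : 1 ≤ k) (hl : 2 * k + 1 ≤ l) (hm : ¬ 3 ∣ m) :
    PD (3 ^ l) (3 ^ (2 * k) * m) % 3 = 0 := by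
  obtain ⟨k, rfl⟩ := Nat.exists_eq_add_of_le' hk
  obtain ⟨d, rfl⟩ := Nat.exists_eq_add_of_le' hl
  refine Nat.mod_eq_zero_of_dvd ((ZMod.natCast_eq_zero_iff _ _).mp ?_)
  rw [cast_PD, show 3 ^ (2 * (k + 1)) * m = 3 * (3 ^ (2 * k + 1) * m) by ring, ← add_assoc,
    coeff_three_mul_genFun]
  refine coeff_mul_expand_eq_zero _ _ _ _ _ fun i j hij ↦ coeff_theta_sq_eq_zero _ ?_
  have hsplit : 3 ^ (d + 2 * (k + 1)) * j = 3 ^ (2 * k + 1) * (3 * (3 ^ d * j)) := by ring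
  rw [hsplit] at hij
  obtain ⟨i, rfl⟩ : 3 ^ (2 * k + 1) ∣ i :=
    (Nat.dvd_add_left (Dvd.intro _ rfl)).mp (hij ▸ Dvd.intro _ rfl)
  rw [← mul_add] at hij
  have := Nat.eq_of_mul_eq_mul_left (by positivity) hij
  exact three_pow_odd_mul_ne_sq_add_sq (by simp) (by lia)

end DesignatedSummands

theorem stmt_19 (n k ℓ : ℕ) (hk : 1 ≤ k) (hℓ : 2 * k + 1 ≤ ℓ) :
    PD (3 ^ ℓ) (3 ^ (2 * k) * (3 * n + 1)) % 3 = 0 ∧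
    PD (3 ^ ℓ) (3 ^ (2 * k) * (3 * n + 2)) % 3 = 0 := by
  exact ⟨PD_three_pow_mod_three k ℓ _ hk hℓ (by lia),
    PD_three_pow_mod_three k ℓ _ hk hℓ (by lia)⟩
end
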